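/- arXiv:2005.14197 — 2 statements merged into one kernel-verified Lean document; each statement's English description precedes it below -/
import Mathlib

section
/- For every integer l ≥ 1 and every complex root z̃ of the polynomial q_l, one has (z̃² + l(l+1))·p_l(z̃) = z̃·q_l′(z̃). (This is the residue computation showing that the residue of z·p_l(z)/q_l(z) at a simple root z̃ of q_l equals z̃²/(z̃² + l(l+1)).) -/
open Polynomial

/-- The polynomial `p_l(z) = ∑_{k=0}^{l} ((l+k)! / (2^k k! (l−k)!)) z^{l−k}`. -/
noncomputable def pPoly (l : ℕ) : Polynomial ℂ :=
  ∑ k ∈ Finset.range (l + 1),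
    C (((l + k).factorial : ℂ) / (2 ^ k * (k.factorial : ℂ) * ((l - k).factorial : ℂ))) *
      X ^ (l - k)

/-- The polynomial `q_l(z) = z p_l'(z) − (z + l) p_l(z)`. -/
noncomputable def qPoly (l : ℕ) : Polynomial ℂ :=
  X * derivative (pPoly l) - (X + C (l : ℂ)) * pPoly l

theorem pPoly_coeff_add (m k : ℕ) :
    (pPoly (m + k)).coeff m =
      ((m + k + k).factorial : ℂ) / (2 ^ k * (k.factorial : ℂ) * (m.factorial : ℂ)) := by
  rw [pPoly, finsetSum_coeff, Finset.sum_eq_single k]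
  · simp
  · intro j hj hjk
    rw [Finset.mem_range] at hj
    rw [coeff_C_mul_X_pow, if_neg (by omega)]
  · intro hk
    exact absurd (Finset.mem_range.mpr (by omega)) hk

theorem pPoly_coeff_of_lt {l m : ℕ} (h : l < m) : (pPoly l).coeff m = 0 := by
  rw [pPoly, finsetSum_coeff]
  refine Finset.sum_eq_zero fun j _ => ?_
  rw [coeff_C_mul_X_pow, if_neg (by omega)]

theorem pPoly_coeff_succ (l m : ℕ) :
    ((m : ℂ) + 1) * (m - 2 * l) * (pPoly l).coeff (m + 1) =
      2 * (m - l) * (pPoly l).coeff m := by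
  rcases lt_trichotomy l m with h | rfl | h
  · rw [pPoly_coeff_of_lt h, pPoly_coeff_of_lt (by omega)]
    ring
  · rw [pPoly_coeff_of_lt (Nat.lt_succ_self l)]
    ring
  · obtain ⟨k, rfl⟩ := Nat.exists_eq_add_of_lt h
    have h₁ := pPoly_coeff_add (m + 1) k
    rw [show m + 1 + k = m + k + 1 by ring] at h₁
    rw [h₁, show m + k + 1 = m + (k + 1) by ring, pPoly_coeff_add m (k + 1),
      show m + (k + 1) + (k + 1) = m + (k + 1) + k + 1 by ring]
    have hk : (k.factorial : ℂ) ≠ 0 := Nat.cast_ne_zero.mpr k.factorial_ne_zero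
    have hm : (m.factorial : ℂ) ≠ 0 := Nat.cast_ne_zero.mpr m.factorial_ne_zero
    have hk' : (k : ℂ) + 1 ≠ 0 := Nat.cast_add_one_ne_zero k
    have hm' : (m : ℂ) + 1 ≠ 0 := Nat.cast_add_one_ne_zero m
    simp only [Nat.factorial_succ (m + (k + 1) + k), Nat.factorial_succ k,
      Nat.factorial_succ m]
    push_cast
    field_simp
    ring

/-- The polynomial form of the modified spherical Bessel equation:
`z p_l'' + 2 l p_l = 2 (z + l) p_l'`. -/
theorem pPoly_differential_equation (l : ℕ) :
    X * derivative (derivative (pPoly l)) + C (2 * (l : ℂ)) * pPoly l =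
      C 2 * ((X + C (l : ℂ)) * derivative (pPoly l)) := by
  ext m
  have h := pPoly_coeff_succ l m
  cases m with
  | zero =>
    simp only [coeff_add, add_mul, coeff_C_mul, coeff_X_mul_zero, coeff_derivative]
    push_cast at h ⊢
    linear_combination h
  | succ m =>
    simp only [coeff_add, add_mul, coeff_C_mul, coeff_X_mul, coeff_derivative]
    push_cast at h ⊢
    linear_combination h

/-- For every `l ≥ 1` and every complex root `z̃` of `q_l`,
`(z̃² + l(l+1)) p_l(z̃) = z̃ q_l'(z̃)` (the residue computation showing that the residue of
`z p_l(z)/q_l(z)` at a simple root `z̃` of `q_l` equals `z̃²/(z̃² + l(l+1))`). -/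
theorem qPoly_root_residue (l : ℕ) (hl : 1 ≤ l) (z : ℂ) (hz : (qPoly l).IsRoot z) :
    (z ^ 2 + (l : ℂ) * ((l : ℂ) + 1)) * (pPoly l).eval z
      = z * (derivative (qPoly l)).eval z := by
  have hode := congrArg (eval z) (pPoly_differential_equation l)
  simp only [IsRoot.def, qPoly, eval_sub, eval_add, eval_mul, eval_X, eval_C] at hz hode
  simp only [qPoly, derivative_sub, derivative_add, derivative_mul, derivative_X, derivative_C,
    eval_sub, eval_add, eval_mul, eval_X, eval_C, eval_one, eval_zero]
  linear_combination -(1 + z + l) * hz - z * hode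
end

section
/- Let l ≥ 1 be an integer, let b, c > 0 be real, and let {z_j}_{j=1}^{l} be the (distinct) complex roots of p_l, each with negative real part. Then for every s ∈ ℂ with Re s > 0, setting z = s·b/c: ∫₀^∞ e^(−s t) · (c/b) · ∑_{j=1}^{l} z_j² · e^{(c/b) z_j t} dt + ∑_{j=1}^{l} z_j = z·( 1 + z + z·k_l′(z)/k_l(z) ). (That is, the kernel ω_l(t) = (c/b)∑_j z_j² e^{(c/b) z_j t} + δ(t)∑_j z_j appearing in the alternative formulation of the capacity operator has Laplace transform z(1 + z + z·k_l′(z)/k_l(z)) with z = s b/c.) -/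
open Polynomial MeasureTheory

/-- The modified spherical Bessel function of the second kind,
`k_l(z) = (π/2) e^{−z} p_l(z) / z^{l+1}`. -/
noncomputable def kFun (l : ℕ) : ℂ → ℂ :=
  fun z => (Real.pi : ℂ) / 2 * Complex.exp (-z) * (pPoly l).eval z / z ^ (l + 1)

lemma pPoly_eq_X_pow_add (l : ℕ) : ∃ q : ℂ[X], q.degree < l ∧ pPoly l = X ^ l + q := by
  refine ⟨∑ k ∈ Finset.range l,
    C (((l + (k + 1)).factorial : ℂ) /
      (2 ^ (k + 1) * ((k + 1).factorial : ℂ) * ((l - (k + 1)).factorial : ℂ))) *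
      X ^ (l - (k + 1)), ?_, ?_⟩
  · refine (degree_sum_le _ _).trans_lt ((Finset.sup_lt_iff (WithBot.bot_lt_coe l)).2 ?_)
    intro k hk
    refine (degree_C_mul_X_pow_le _ _).trans_lt ?_
    have := Finset.mem_range.1 hk
    exact Nat.cast_lt.2 (by omega)
  · rw [pPoly, Finset.sum_range_succ', add_comm]
    have : (l.factorial : ℂ) ≠ 0 := Nat.cast_ne_zero.2 l.factorial_ne_zero
    simp [div_self this]

lemma pPoly_monic (l : ℕ) : (pPoly l).Monic := by
  obtain ⟨q, hq, h⟩ := pPoly_eq_X_pow_add l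
  exact h ▸ monic_X_pow_add hq

lemma natDegree_pPoly (l : ℕ) : (pPoly l).natDegree = l := by
  obtain ⟨q, hq, h⟩ := pPoly_eq_X_pow_add l
  rw [h, natDegree_eq_of_degree_eq_some]
  rw [degree_add_eq_left_of_degree_lt] <;> simp [hq]

lemma pPoly_eq_prod {l : ℕ} {r : Fin l → ℂ} (hinj : Function.Injective r)
    (hroot : ∀ j, (pPoly l).IsRoot (r j)) : pPoly l = ∏ j, (X - C (r j)) := by
  have hdvd : ∏ j, (X - C (r j)) ∣ pPoly l :=
    Finset.prod_dvd_of_coprime (fun i _ j _ hij => pairwise_coprime_X_sub_C hinj hij)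
      fun j _ => dvd_iff_isRoot.2 (hroot j)
  refine (eq_of_monic_of_dvd_of_natDegree_le
    (monic_prod_of_monic _ _ fun j _ => monic_X_sub_C _) (pPoly_monic l) hdvd ?_)
  rw [natDegree_pPoly, natDegree_prod_of_monic _ _ fun j _ => monic_X_sub_C _]
  simp

/-- The logarithmic derivative of `k_l` away from its zeros and the origin. -/
lemma deriv_kFun_div_kFun {l : ℕ} {r : Fin l → ℂ} (hp : pPoly l = ∏ j, (X - C (r j)))
    {z : ℂ} (hz : z ≠ 0) (hne : ∀ j, z - r j ≠ 0) :
    deriv (kFun l) z / kFun l z = -1 + ∑ j, 1 / (z - r j) - (l + 1) / z := by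
  have hk : kFun l = fun w =>
      (Real.pi / 2 * Complex.exp (-w) * ∏ j, (w - r j)) / w ^ (l + 1) := by
    ext w
    simp [kFun, hp, eval_prod]
  have hpi : (Real.pi / 2 : ℂ) ≠ 0 := by simp [Real.pi_ne_zero]
  have hexp : logDeriv (fun w : ℂ => Real.pi / 2 * Complex.exp (-w)) z = -1 := by
    have hd : HasDerivAt (fun w : ℂ => Real.pi / 2 * Complex.exp (-w))
        (Real.pi / 2 * (Complex.exp (-z) * -1)) z :=
      ((hasDerivAt_neg z).cexp).const_mul _
    rw [logDeriv_apply, hd.deriv]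
    field_simp [Complex.exp_ne_zero]
  have hprod : logDeriv (fun w => ∏ j, (w - r j)) z = ∑ j, 1 / (z - r j) := by
    rw [logDeriv_prod (fun j _ => hne j) (fun j _ => by fun_prop)]
    simp [logDeriv_apply]
  have hexp_ne : (Real.pi / 2 : ℂ) * Complex.exp (-z) ≠ 0 :=
    mul_ne_zero hpi (Complex.exp_ne_zero _)
  have hprod_ne : ∏ j, (z - r j) ≠ 0 := Finset.prod_ne_zero_iff.2 fun j _ => hne j
  rw [← logDeriv_apply, hk,
    logDeriv_div (f := fun w => Real.pi / 2 * Complex.exp (-w) * ∏ j, (w - r j))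
      (g := fun w => w ^ (l + 1)) z (mul_ne_zero hexp_ne hprod_ne) (pow_ne_zero _ hz)
      (by fun_prop) (by fun_prop),
    logDeriv_mul (f := fun w : ℂ => Real.pi / 2 * Complex.exp (-w))
      (g := fun w => ∏ j, (w - r j)) z hexp_ne hprod_ne (by fun_prop) (by fun_prop),
    hexp, hprod, logDeriv_pow]
  push_cast
  rfl

/-- The Laplace transform of a finite sum of exponentials. -/
lemma integral_exp_mul_sum_exp {ι : Type*} [Fintype ι] (a r : ι → ℂ) {s : ℂ}
    (h : ∀ j, (r j).re < s.re) :
    ∫ t in Set.Ioi (0 : ℝ), Complex.exp (-s * t) * ∑ j, a j * Complex.exp (r j * t)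
      = ∑ j, a j / (s - r j) := by
  have heq : ∀ t : ℝ, Complex.exp (-s * t) * ∑ j, a j * Complex.exp (r j * t)
      = ∑ j, a j * Complex.exp ((r j - s) * t) := fun t => by
    rw [Finset.mul_sum]
    refine Finset.sum_congr rfl fun j _ => ?_
    rw [mul_left_comm, ← Complex.exp_add]
    ring_nf
  have hneg : ∀ j, (r j - s).re < 0 := fun j => by simpa using h j
  simp_rw [heq]
  rw [integral_finsetSum _ fun j _ => (integrableOn_exp_mul_complex_Ioi (hneg j) 0).const_mul _]
  refine Finset.sum_congr rfl fun j _ => ?_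
  rw [integral_const_mul, integral_exp_mul_complex_Ioi (hneg j), ← neg_sub s (r j),
    neg_div_neg_eq]
  simp [div_eq_mul_inv]

/-- The kernel `ω_l(t) = (c/b) ∑_j z_j² e^{(c/b) z_j t} + δ(t) ∑_j z_j`, where `{z_j}` are
the distinct roots of `p_l` (all with negative real part), has Laplace transform
`z (1 + z + z k_l′(z)/k_l(z))` with `z = s b / c`, for every `s` with `Re s > 0`. -/
theorem omega_kernel_laplace_transform (l : ℕ) (hl : 1 ≤ l) (b c : ℝ)
    (hb : 0 < b) (hc : 0 < c) (zt : Fin l → ℂ) (hinj : Function.Injective zt)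
    (hroot : ∀ j, (pPoly l).IsRoot (zt j)) (hre : ∀ j, (zt j).re < 0)
    (s : ℂ) (hs : 0 < s.re) :
    (∫ t in Set.Ioi (0 : ℝ),
        Complex.exp (-s * t) *
          ((c / b : ℂ) * ∑ j, (zt j) ^ 2 * Complex.exp ((c / b : ℂ) * zt j * t)))
      + ∑ j, zt j
      = (s * b / c) *
          (1 + s * b / c
            + (s * b / c) * deriv (kFun l) (s * b / c) / kFun l (s * b / c)) := by
  have hb0 : (b : ℂ) ≠ 0 := Complex.ofReal_ne_zero.2 hb.ne'
  have hc0 : (c : ℂ) ≠ 0 := Complex.ofReal_ne_zero.2 hc.ne'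
  have hlt : ∀ j, ((c / b : ℂ) * zt j).re < s.re := fun j => by
    rw [← Complex.ofReal_div, Complex.re_ofReal_mul]
    exact (mul_neg_of_pos_of_neg (div_pos hc hb) (hre j)).trans hs
  have hkernel : ∀ t : ℝ, (c / b : ℂ) * ∑ j, zt j ^ 2 * Complex.exp (c / b * zt j * t)
      = ∑ j, c / b * zt j ^ 2 * Complex.exp (c / b * zt j * t) := fun t => by
    simp only [Finset.mul_sum, mul_assoc]
  simp_rw [hkernel]
  rw [integral_exp_mul_sum_exp _ _ hlt]
  obtain ⟨z, hz⟩ : ∃ z : ℂ, z = s * b / c := ⟨_, rfl⟩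
  have hsz : s = c / b * z := by rw [hz]; field_simp
  have hzre : 0 < z.re := by
    rw [hz, mul_div_assoc, ← Complex.ofReal_div, Complex.re_mul_ofReal]
    positivity
  have hz0 : z ≠ 0 := fun h => by simp [h] at hzre
  have hne : ∀ j, z - zt j ≠ 0 := fun j h => by
    have := hre j
    rw [← sub_eq_zero.1 h] at this
    exact this.not_gt hzre
  rw [← hz, mul_div_assoc, deriv_kFun_div_kFun (pPoly_eq_prod hinj hroot) hz0 hne,
    ← Finset.sum_add_distrib]
  have hterm : ∀ j, c / b * zt j ^ 2 / (s - c / b * zt j) + zt j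
      = z ^ 2 * (1 / (z - zt j)) - z := fun j => by
    have := hne j
    rw [hsz, ← mul_sub, mul_div_mul_left _ _ (div_ne_zero hc0 hb0)]
    field_simp
    ring
  rw [Finset.sum_congr rfl fun j _ => hterm j, Finset.sum_sub_distrib, ← Finset.mul_sum]
  simp only [Finset.sum_const, Finset.card_univ, Fintype.card_fin, nsmul_eq_mul]
  field_simp
  ring
end
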